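/- Let N ≥ 2 be an even integer, k = N/2, and let f : [0,1) → [0,∞) be continuous with f(0) = 0 and f(r) > 0 for r ∈ (0,1). Then for every β > μ_N, the supremum sup { ∫₀¹ r^{N−1} exp(β |v(r)|^{(N+2)/N + f(r)}) dr : v ∈ X_1, ‖v‖_{X_1} = 1 } equals +∞. -/

import Mathlib

open MeasureTheory Real Set Filter
open scoped ENNReal

/-- Surface area of the unit sphere in `ℝ^N` (equals `N` times the volume of the unit ball). -/
noncomputable def omegaS (N : ℕ) : ℝ :=
  N * (volume (Metric.ball (0 : EuclideanSpace ℝ (Fin N)) 1)).toReal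

/-- The normalising constant `c_N = ω_{N-1} · binom(N,k) / N`. -/
noncomputable def cN (N k : ℕ) : ℝ := omegaS N * (N.choose k) / N

/-- The critical constant `μ_N = N · (ω_{N-1} · binom(N-1,k-1) / k)^{2/N}`. -/
noncomputable def muN (N k : ℕ) : ℝ :=
  N * (omegaS N * ((N - 1).choose (k - 1)) / k) ^ ((2 : ℝ) / N)

/-- Membership in the weighted space `X₁`: `v` is locally absolutely continuous on `(0,1)`
with derivative `v'` (in the sense of the fundamental theorem of calculus),
`v(r) → 0` as `r → 1⁻`, and the two defining weighted integrals are finite. -/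
structure MemX1 (N k : ℕ) (v v' : ℝ → ℝ) : Prop where
  locAC : ∀ a ∈ Ioo (0:ℝ) 1, ∀ b ∈ Ioo (0:ℝ) 1,
    IntervalIntegrable v' volume a b ∧ v b - v a = ∫ t in a..b, v' t
  lim_one : Tendsto v (nhdsWithin 1 (Iio 1)) (nhds 0)
  grad_int : ∫⁻ r in Ioo (0:ℝ) 1, ENNReal.ofReal (r ^ (N - k) * |v' r| ^ (k + 1)) < ⊤
  fun_int : ∫⁻ r in Ioo (0:ℝ) 1, ENNReal.ofReal (r ^ (N - 1) * |v r| ^ (k + 1)) < ⊤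

/-- The norm on `X₁`: `‖v‖ = (c_N ∫₀¹ r^{N-k} |v'|^{k+1} dr)^{1/(k+1)}`. -/
noncomputable def normX1 (N k : ℕ) (v' : ℝ → ℝ) : ℝ :=
  (cN N k * ∫ r in Ioo (0:ℝ) 1, r ^ (N - k) * |v' r| ^ (k + 1)) ^ (1 / (k + 1 : ℝ))

/-- The supercritical Trudinger–Moser integral `∫₀¹ r^{N-1} exp(β |v|^{(N+2)/N + f(r)}) dr`. -/
noncomputable def mtIntegral (N : ℕ) (β : ℝ) (f v : ℝ → ℝ) : ℝ≥0∞ :=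
  ∫⁻ r in Ioo (0:ℝ) 1,
    ENNReal.ofReal (r ^ (N - 1) * exp (β * |v r| ^ (((N : ℝ) + 2) / N + f r)))

/-- The truncated logarithm `A · log (1 / max r ε)` of Moser type. -/
noncomputable def moserFun (A ε : ℝ) (r : ℝ) : ℝ := -A * log (max r ε)

/-- The right derivative of `moserFun A ε` on the positive half-line. -/
noncomputable def moserDeriv (A ε : ℝ) (r : ℝ) : ℝ := if r < ε then 0 else -A * r⁻¹

lemma measurable_moserDeriv (A ε : ℝ) : Measurable (moserDeriv A ε) :=
  Measurable.ite measurableSet_Iio measurable_const (measurable_inv.const_mul _)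

lemma abs_moserDeriv_le {A ε : ℝ} (hA : 0 < A) (hε : 0 < ε) (r : ℝ) :
    |moserDeriv A ε r| ≤ A * ε⁻¹ := by
  unfold moserDeriv
  split_ifs with h
  · rw [abs_zero]; positivity
  · push Not at h
    have : 0 < r := hε.trans_le h
    rw [abs_mul, abs_neg, abs_of_pos hA, abs_of_pos (inv_pos.2 this)]
    gcongr

lemma continuous_moserFun (A : ℝ) {ε : ℝ} (hε : 0 < ε) : Continuous (moserFun A ε) := by
  unfold moserFun
  refine continuous_const.mul (Continuous.log (by fun_prop) fun x => ?_)
  exact (hε.trans_le (le_max_right _ _)).ne'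

lemma hasDerivWithinAt_moserFun (A : ℝ) {ε : ℝ} (hε : 0 < ε) (x : ℝ) :
    HasDerivWithinAt (moserFun A ε) (moserDeriv A ε x) (Ioi x) x := by
  unfold moserDeriv
  split_ifs with h
  · refine HasDerivAt.hasDerivWithinAt ?_
    refine (hasDerivAt_const x (-A * log ε)).congr_of_eventuallyEq ?_
    filter_upwards [Iio_mem_nhds h] with y hy
    rw [moserFun, max_eq_right (le_of_lt hy)]
  · push Not at h
    have hx : 0 < x := hε.trans_le h
    refine ((hasDerivAt_log hx.ne').const_mul (-A)).hasDerivWithinAt.congr (fun y hy => ?_) ?_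
    · rw [moserFun, max_eq_left (h.trans (le_of_lt hy))]
    · rw [moserFun, max_eq_left h]

lemma intervalIntegrable_moserDeriv {A ε : ℝ} (hA : 0 < A) (hε : 0 < ε) (a b : ℝ) :
    IntervalIntegrable (moserDeriv A ε) volume a b := by
  refine (intervalIntegrable_const (c := A * ε⁻¹)).mono_fun
    (measurable_moserDeriv A ε).aestronglyMeasurable (Eventually.of_forall fun r => ?_)
  rw [Real.norm_eq_abs]
  exact (abs_moserDeriv_le hA hε r).trans (le_abs_self _)

lemma setLIntegral_ofReal_lt_top {s : Set ℝ} (hsm : MeasurableSet s) (hs : volume s < ⊤)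
    {g : ℝ → ℝ} {C : ℝ}
    (h : ∀ r ∈ s, g r ≤ C) : ∫⁻ r in s, ENNReal.ofReal (g r) < ⊤ := by
  calc ∫⁻ r in s, ENNReal.ofReal (g r) ≤ ∫⁻ _ in s, ENNReal.ofReal C :=
        setLIntegral_mono' hsm fun r hr => ENNReal.ofReal_le_ofReal (h r hr)
    _ < ⊤ := by
        rw [setLIntegral_const]
        exact ENNReal.mul_lt_top ENNReal.ofReal_lt_top hs

lemma abs_moserFun_le {A ε : ℝ} (hA : 0 < A) (hε : 0 < ε) (hε1 : ε < 1) {r : ℝ}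
    (hr : r < 1) : |moserFun A ε r| ≤ A * -log ε := by
  have hm : ε ≤ max r ε := le_max_right _ _
  have h1 : log ε ≤ log (max r ε) := log_le_log hε hm
  have h2 : log (max r ε) ≤ 0 := log_nonpos (hε.le.trans hm) (max_le hr.le hε1.le)
  rw [moserFun, abs_mul, abs_neg, abs_of_pos hA, abs_of_nonpos h2]
  gcongr

lemma memX1_moserFun (N k : ℕ) {A ε : ℝ} (hA : 0 < A) (hε : 0 < ε) (hε1 : ε < 1) :
    MemX1 N k (moserFun A ε) (moserDeriv A ε) where
  locAC a _ b _ := by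
    refine ⟨intervalIntegrable_moserDeriv hA hε a b, ?_⟩
    exact (intervalIntegral.integral_eq_sub_of_hasDeriv_right
      (continuous_moserFun A hε).continuousOn
      (fun x _ => hasDerivWithinAt_moserFun A hε x)
      (intervalIntegrable_moserDeriv hA hε a b)).symm
  lim_one := by
    have h := ((continuous_moserFun A hε).tendsto 1).mono_left
      (nhdsWithin_le_nhds (s := Iio 1))
    rwa [show moserFun A ε 1 = 0 by rw [moserFun, max_eq_left hε1.le]; simp] at h
  grad_int := by
    refine setLIntegral_ofReal_lt_top (C := (A * ε⁻¹) ^ (k + 1)) measurableSet_Ioo (by simp)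
      fun r hr => ?_
    have h1 : r ^ (N - k) ≤ 1 := pow_le_one₀ hr.1.le hr.2.le
    have h2 := pow_le_pow_left₀ (abs_nonneg _) (abs_moserDeriv_le hA hε r) (k + 1)
    exact (mul_le_of_le_one_left (by positivity) h1).trans h2
  fun_int := by
    refine setLIntegral_ofReal_lt_top (C := (A * -log ε) ^ (k + 1)) measurableSet_Ioo (by simp)
      fun r hr => ?_
    have h1 : r ^ (N - 1) ≤ 1 := pow_le_one₀ hr.1.le hr.2.le
    have h2 := pow_le_pow_left₀ (abs_nonneg _) (abs_moserFun_le hA hε hε1 hr.2) (k + 1)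
    exact (mul_le_of_le_one_left (by positivity) h1).trans h2

lemma integral_moserDeriv (k : ℕ) {A ε : ℝ} (hA : 0 < A) (hε : 0 < ε) (hε1 : ε < 1) :
    ∫ r in Ioo (0:ℝ) 1, r ^ k * |moserDeriv A ε r| ^ (k + 1) = A ^ (k + 1) * -log ε := by
  have h1 : ∀ r ∈ Ioo (0:ℝ) 1, r ^ k * |moserDeriv A ε r| ^ (k + 1)
      = (Ici ε).indicator (fun r => A ^ (k + 1) * r⁻¹) r := by
    intro r hr
    have hr0 : 0 < r := hr.1
    by_cases h : r < ε
    · rw [indicator_of_notMem (by simpa using h), moserDeriv, if_pos h]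
      simp
    · rw [indicator_of_mem (by simpa using h), moserDeriv, if_neg h, abs_mul, abs_neg,
        abs_of_pos hA, abs_of_pos (inv_pos.2 hr0), mul_pow, inv_pow]
      field_simp
      ring
  rw [setIntegral_congr_fun measurableSet_Ioo h1, setIntegral_indicator measurableSet_Ici,
    show Ioo (0:ℝ) 1 ∩ Ici ε = Ico ε 1 by
      ext x
      simp only [mem_inter_iff, mem_Ioo, mem_Ici, mem_Ico]
      exact ⟨fun h => ⟨h.2, h.1.2⟩, fun h => ⟨⟨hε.trans_le h.1, h.2⟩, h.1⟩⟩,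
    integral_Ico_eq_integral_Ioc, ← intervalIntegral.integral_of_le hε1.le,
    intervalIntegral.integral_const_mul, integral_inv_of_pos hε one_pos, one_div, log_inv]

lemma omegaS_pos {N : ℕ} (hN : 0 < N) : 0 < omegaS N := by
  unfold omegaS
  have h : 0 < (volume (Metric.ball (0 : EuclideanSpace ℝ (Fin N)) 1)).toReal :=
    ENNReal.toReal_pos (Metric.measure_ball_pos _ _ one_pos).ne' measure_ball_lt_top.ne
  positivity

lemma cN_pos {k : ℕ} (hk : 0 < k) : 0 < cN (2 * k) k := by
  have h1 := omegaS_pos (N := 2 * k) (by omega)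
  have h2 : 0 < (2 * k).choose k := Nat.choose_pos (by omega)
  unfold cN
  positivity

lemma muN_eq {k : ℕ} (hk : 0 < k) :
    muN (2 * k) k = (2 * k : ℕ) * cN (2 * k) k ^ ((1 : ℝ) / k) := by
  have hk' : (k : ℝ) ≠ 0 := by positivity
  have h : (2 * k).choose k = 2 * (2 * k - 1).choose (k - 1) := by
    obtain ⟨m, rfl⟩ : ∃ m, k = m + 1 := ⟨k - 1, by omega⟩
    have h := Nat.add_one_mul_choose_eq (2 * m + 1) m
    rw [show 2 * (m + 1) = 2 * m + 1 + 1 by ring]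
    simp only [Nat.add_sub_cancel]
    have : (m + 1) * (2 * m + 1 + 1).choose (m + 1)
        = (m + 1) * (2 * (2 * m + 1).choose m) := by linarith
    exact Nat.eq_of_mul_eq_mul_left (by omega) this
  unfold muN cN
  rw [h]
  congr 2
  · push_cast; field_simp
  · push_cast; field_simp

/-- Lower bound for the Trudinger–Moser integral of a Moser function, coming from the plateau. -/
lemma le_mtIntegral_moserFun {N : ℕ} {β : ℝ} (hβ : 0 ≤ β) {f : ℝ → ℝ}
    (hf : ∀ r ∈ Ioo (0:ℝ) 1, 0 ≤ f r) (hN : 0 < N)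
    {A ε : ℝ} (hε : 0 < ε) (hε1 : ε < 1) (hV : 1 ≤ A * -log ε) :
    ENNReal.ofReal ((ε / 2) ^ N * exp (β * (A * -log ε) ^ (((N : ℝ) + 2) / N)))
      ≤ mtIntegral N β f (moserFun A ε) := by
  set M := exp (β * (A * -log ε) ^ (((N : ℝ) + 2) / N)) with hM
  have hsub : Ioo (ε / 2) ε ⊆ Ioo (0:ℝ) 1 := Ioo_subset_Ioo (by positivity) hε1.le
  calc ENNReal.ofReal ((ε / 2) ^ N * M)
      = ∫⁻ _ in Ioo (ε / 2) ε, ENNReal.ofReal ((ε / 2) ^ (N - 1) * M) := by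
        rw [setLIntegral_const, Real.volume_Ioo, ← ENNReal.ofReal_mul (by positivity)]
        congr 1
        obtain ⟨m, rfl⟩ : ∃ m, N = m + 1 := ⟨N - 1, by omega⟩
        simp only [Nat.add_sub_cancel]
        ring
    _ ≤ ∫⁻ r in Ioo (ε / 2) ε, ENNReal.ofReal (r ^ (N - 1) *
          exp (β * |moserFun A ε r| ^ (((N : ℝ) + 2) / N + f r))) := by
        refine setLIntegral_mono' measurableSet_Ioo fun r hr => ENNReal.ofReal_le_ofReal ?_
        have hv : |moserFun A ε r| = A * -log ε := by
          rw [moserFun, max_eq_right hr.2.le, neg_mul_comm, abs_of_nonneg (by linarith)]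
        have hf' := hf r (hsub hr)
        rw [hv, hM]
        gcongr
        · have := hsub hr; exact pow_nonneg this.1.le _
        · exact hr.1.le
        · linarith
    _ ≤ mtIntegral N β f (moserFun A ε) := lintegral_mono_set hsub

theorem stmt6 (N k : ℕ) (hk : 0 < k) (hN : N = 2 * k)
    (f : ℝ → ℝ) (hfc : ContinuousOn f (Ico 0 1)) (hf0 : f 0 = 0)
    (hfpos : ∀ r ∈ Ioo (0:ℝ) 1, 0 < f r) (hfnn : ∀ r ∈ Ico (0:ℝ) 1, 0 ≤ f r)
    (β : ℝ) (hβ : muN N k < β) :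
    (⨆ p : {p : (ℝ → ℝ) × (ℝ → ℝ) // MemX1 N k p.1 p.2 ∧ normX1 N k p.2 = 1},
      mtIntegral N β f p.1.1) = ⊤ := by
  subst hN
  set c := cN (2 * k) k with hc
  have hcpos : 0 < c := cN_pos hk
  have hkR : (0 : ℝ) < k := by exact_mod_cast hk
  rw [muN_eq hk, ← hc] at hβ
  set q := c ^ ((1 : ℝ) / k) with hq
  have hqpos : 0 < q := rpow_pos_of_pos hcpos _
  have hβ0 : 0 ≤ β := le_trans (by positivity) hβ.le
  have hd : 0 < β / q - (2 * k : ℕ) := by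
    rw [sub_pos, lt_div_iff₀ hqpos]; exact hβ
  refine ENNReal.eq_top_of_forall_nnreal_le fun x => ?_
  have htend : Tendsto (fun L : ℝ => exp ((β / q - (2 * k : ℕ)) * L)) atTop atTop :=
    tendsto_exp_atTop.comp (tendsto_id.const_mul_atTop hd)
  obtain ⟨L, hLx, hL1, hLc⟩ := ((htend.eventually_ge_atTop (x * 2 ^ (2 * k))).and
    ((eventually_ge_atTop 1).and (eventually_ge_atTop c))).exists
  have hL0 : 0 < L := by linarith
  set A := (c * L)⁻¹ ^ ((k + 1 : ℕ) : ℝ)⁻¹ with hA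
  have hApos : 0 < A := rpow_pos_of_pos (by positivity) _
  have hApow : A ^ (k + 1) = (c * L)⁻¹ := rpow_inv_natCast_pow (by positivity) (by omega)
  have hlog : -log (exp (-L)) = L := by rw [log_exp, neg_neg]
  have hε : 0 < exp (-L) := exp_pos _
  have hε1 : exp (-L) < 1 := by rw [exp_lt_one_iff]; linarith
  have hVpow : (A * L) ^ (k + 1) = L ^ k / c := by
    rw [mul_pow, hApow]
    field_simp
    ring
  have hV1 : 1 ≤ A * L := by
    rw [← one_le_pow_iff_of_nonneg (by positivity) (Nat.succ_ne_zero k), hVpow, le_div_iff₀ hcpos,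
      one_mul]
    exact hLc.trans (le_self_pow₀ hL1 hk.ne')
  have hVrpow : (A * L) ^ ((((2 * k : ℕ) : ℝ) + 2) / (2 * k : ℕ)) = L / q := by
    rw [show (((2 * k : ℕ) : ℝ) + 2) / (2 * k : ℕ) = ((k + 1 : ℕ) : ℝ) * (1 / k) by
      push_cast; field_simp, rpow_mul (by positivity), rpow_natCast, hVpow,
      div_rpow (by positivity) hcpos.le, one_div, pow_rpow_inv_natCast hL0.le hk.ne', hq, one_div]
  have hnorm : normX1 (2 * k) k (moserDeriv A (exp (-L))) = 1 := by
    rw [normX1, show 2 * k - k = k by omega, integral_moserDeriv k hApos hε hε1, hlog, hApow, ← hc,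
      show c * ((c * L)⁻¹ * L) = 1 by field_simp, one_rpow]
  have hlow := le_mtIntegral_moserFun (N := 2 * k) (A := A) hβ0
    (fun r hr => (hfpos r hr).le) (by omega) hε hε1 (by rwa [hlog])
  rw [hlog, hVrpow] at hlow
  refine le_trans ?_ (hlow.trans (le_iSup (fun p : {p : (ℝ → ℝ) × (ℝ → ℝ) //
    MemX1 (2 * k) k p.1 p.2 ∧ normX1 (2 * k) k p.2 = 1} => mtIntegral (2 * k) β f p.1.1)
    ⟨(moserFun A (exp (-L)), moserDeriv A (exp (-L))),
      memX1_moserFun (2 * k) k hApos hε hε1, hnorm⟩))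
  rw [← ENNReal.ofReal_coe_nnreal]
  refine ENNReal.ofReal_le_ofReal ?_
  rw [div_pow, ← exp_nat_mul, div_mul_eq_mul_div, ← exp_add, le_div_iff₀ (by positivity)]
  refine hLx.trans_eq ?_
  congr 1
  ring
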